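/- arXiv:2101.01530 — 2 statements merged into one kernel-verified Lean document; each statement's English description precedes it below -/
import Mathlib

section
/- Let G = (N, A) be a finite directed graph without self-loops, let s ∈ N, let x : A → ℝ with x ≥ 0 and y : N → ℝ with 0 ≤ y ≤ 1. Let σ₁ ⊆ V' ⊆ N \ {s} and let k ∈ N \ {s} with k ∉ V'. Suppose that at the vertex k the total x-value on arcs leaving k equals y_k and the total x-value on arcs entering k equals the total x-value on arcs leaving k. If the sum of x over δ⁻(V') is strictly less than Σ_{i ∈ σ₁} y_i, then the sum of x over δ⁻(V' ∪ {k}) is strictly less than Σ_{i ∈ σ₁ ∪ {k}} y_i. In particular, a violated clique conflict cut for the clique σ₁ over the set V' yields a violated clique conflict cut for the larger clique σ₁ ∪ {k} over the set V' ∪ {k}. -/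
/-- One step of the clique conflict cut dominance argument.
If `σ₁ ⊆ V' ⊆ N \ {s}`, `k ∈ N \ {s}`, `k ∉ V'`, `x ≥ 0`, `0 ≤ y ≤ 1`, the total
`x`-value on arcs leaving `k` equals `y k`, flow is balanced at `k`, and the clique
conflict cut `Σ_{δ⁻(V')} x ≥ Σ_{i ∈ σ₁} y i` is violated, then the clique conflict
cut for `σ₁ ∪ {k}` over `V' ∪ {k}` is violated as well. -/
theorem clique_conflict_cut_violation_lift
    {V : Type*} [Fintype V] [DecidableEq V]
    (A : Finset (V × V)) (hA : ∀ a ∈ A, a.1 ≠ a.2)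
    (s : V)
    (x : V × V → ℝ) (hx : ∀ a, 0 ≤ x a)
    (y : V → ℝ) (hy0 : ∀ v, 0 ≤ y v) (hy1 : ∀ v, y v ≤ 1)
    (σ₁ V' : Finset V) (hσV : σ₁ ⊆ V') (hVs : s ∉ V')
    (k : V) (hks : k ≠ s) (hkV : k ∉ V')
    (hout : ∑ e ∈ A.filter (fun e => e.1 = k), x e = y k)
    (hbal : ∑ e ∈ A.filter (fun e => e.2 = k), x e =
            ∑ e ∈ A.filter (fun e => e.1 = k), x e)
    (hviol : ∑ e ∈ A.filter (fun e => e.1 ∉ V' ∧ e.2 ∈ V'), x e < ∑ i ∈ σ₁, y i) :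
    ∑ e ∈ A.filter (fun e => e.1 ∉ insert k V' ∧ e.2 ∈ insert k V'), x e <
      ∑ i ∈ insert k σ₁, y i := by
  have hkσ : k ∉ σ₁ := fun h => hkV (hσV h)
  rw [Finset.sum_insert hkσ]
  have hle : ∑ e ∈ A.filter (fun e => e.1 ∉ insert k V' ∧ e.2 ∈ insert k V'), x e ≤
      ∑ e ∈ A.filter (fun e => e.2 = k), x e +
        ∑ e ∈ A.filter (fun e => e.1 ∉ V' ∧ e.2 ∈ V'), x e := by
    rw [← Finset.sum_union]
    · apply Finset.sum_le_sum_of_subset_of_nonneg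
      · intro e he
        simp only [Finset.mem_filter, Finset.mem_union, Finset.mem_insert] at he ⊢
        tauto
      · intro e _ _
        exact hx e
    · rw [Finset.disjoint_left]
      intro e h1 h2
      simp only [Finset.mem_filter] at h1 h2
      exact hkV (h1.2 ▸ h2.2.2)
  linarith
end

section
/- Let G = (N, A) be a finite directed graph without self-loops, let s ∈ N, let x : A → ℝ with x ≥ 0 and y : N → ℝ with 0 ≤ y ≤ 1. Let σ₁ ⊆ σ₂ ⊆ N \ {s} and let V' ⊆ N \ {s} with σ₁ ⊆ V' and V' ∩ (σ₂ \ σ₁) = ∅. Suppose that at every vertex k ∈ σ₂ \ σ₁ the total x-value on arcs leaving k equals y_k and the total x-value on arcs entering k equals the total x-value on arcs leaving k. If Σ_{e ∈ δ⁻(V')} x_e < Σ_{i ∈ σ₁} y_i, then Σ_{e ∈ δ⁻(V' ∪ (σ₂ \ σ₁))} x_e < Σ_{i ∈ σ₂} y_i. In particular, any fractional point violating a clique conflict cut based on a clique σ₁ also violates a clique conflict cut based on any superset clique σ₂, so that clique conflict cuts based on larger cliques dominate those based on sub-cliques (and hence dominate general connectivity constraints, which are the case |σ| = 1, and pairwise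 conflict cuts, which are the case |σ| = 2). -/
/-- Dominance of clique conflict cuts based on larger cliques.
If `σ₁ ⊆ σ₂ ⊆ N \ {s}`, `σ₁ ⊆ V' ⊆ N \ {s}`, `V' ∩ (σ₂ \ σ₁) = ∅`, `x ≥ 0`,
`0 ≤ y ≤ 1`, and at every `k ∈ σ₂ \ σ₁` the total `x`-value on arcs leaving `k`
equals `y k` and flow is balanced, then violation of the cut
`Σ_{δ⁻(V')} x ≥ Σ_{i ∈ σ₁} y i` implies violation of the cut
`Σ_{δ⁻(V' ∪ (σ₂ \ σ₁))} x ≥ Σ_{i ∈ σ₂} y i`. -/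
theorem clique_conflict_cut_dominance
    {V : Type*} [Fintype V] [DecidableEq V]
    (A : Finset (V × V)) (hA : ∀ a ∈ A, a.1 ≠ a.2)
    (s : V)
    (x : V × V → ℝ) (hx : ∀ a, 0 ≤ x a)
    (y : V → ℝ) (hy0 : ∀ v, 0 ≤ y v) (hy1 : ∀ v, y v ≤ 1)
    (σ₁ σ₂ V' : Finset V) (hσ12 : σ₁ ⊆ σ₂) (hσ2s : s ∉ σ₂)
    (hσV : σ₁ ⊆ V') (hVs : s ∉ V') (hVdisj : V' ∩ (σ₂ \ σ₁) = ∅)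
    (hflow : ∀ k ∈ σ₂ \ σ₁,
        (∑ e ∈ A.filter (fun e => e.1 = k), x e = y k) ∧
        (∑ e ∈ A.filter (fun e => e.2 = k), x e =
         ∑ e ∈ A.filter (fun e => e.1 = k), x e))
    (hviol : ∑ e ∈ A.filter (fun e => e.1 ∉ V' ∧ e.2 ∈ V'), x e < ∑ i ∈ σ₁, y i) :
    ∑ e ∈ A.filter
        (fun e => e.1 ∉ V' ∪ (σ₂ \ σ₁) ∧ e.2 ∈ V' ∪ (σ₂ \ σ₁)), x e <
      ∑ i ∈ σ₂, y i := by
  have h1 : ∑ e ∈ A.filter (fun e => e.2 ∈ σ₂ \ σ₁), x e = ∑ k ∈ σ₂ \ σ₁, y k := by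
    rw [← Finset.sum_fiberwise_of_maps_to (t := σ₂ \ σ₁) (g := fun e : V × V => e.2)
      (fun e he => (Finset.mem_filter.mp he).2)]
    refine Finset.sum_congr rfl fun k hk => ?_
    rw [← (hflow k hk).1, ← (hflow k hk).2, Finset.filter_filter]
    refine Finset.sum_congr (Finset.filter_congr fun e _ => ?_) fun _ _ => rfl
    constructor
    · exact fun h => h.2
    · exact fun h => ⟨h ▸ hk, h⟩
  have h2 : ∑ e ∈ A.filter
        (fun e => e.1 ∉ V' ∪ (σ₂ \ σ₁) ∧ e.2 ∈ V' ∪ (σ₂ \ σ₁)), x e ≤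
      ∑ e ∈ A.filter (fun e => e.1 ∉ V' ∧ e.2 ∈ V') ∪ A.filter (fun e => e.2 ∈ σ₂ \ σ₁), x e := by
    refine Finset.sum_le_sum_of_subset_of_nonneg ?_ fun e _ _ => hx e
    intro e he
    simp only [Finset.mem_filter, Finset.mem_union] at he ⊢
    tauto
  have h3 := Finset.sum_union_inter (f := x)
    (s₁ := A.filter (fun e => e.1 ∉ V' ∧ e.2 ∈ V')) (s₂ := A.filter (fun e => e.2 ∈ σ₂ \ σ₁))
  have h4 : 0 ≤ ∑ e ∈ A.filter (fun e => e.1 ∉ V' ∧ e.2 ∈ V') ∩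
      A.filter (fun e => e.2 ∈ σ₂ \ σ₁), x e := Finset.sum_nonneg fun e _ => hx e
  have h5 := Finset.sum_sdiff (f := y) hσ12
  linarith
end
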